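/- arXiv:2301.10806 — 2 statements merged into one kernel-verified Lean document; each statement's English description precedes it below -/
import Mathlib

section
/- Let μ ∈ 𝒥_n be a soliton and let x ∈ ℂⁿ satisfy D_μ x = d·x for some real d ≠ 0, where D_μ := M_μ − c_μ·I and c_μ := −Tr(M_μ²)/‖μ‖². Then x is nilpotent: setting x^{(1)} := x and x^{(k+1)} := μ(x, x^{(k)}), there exists k ≥ 1 with x^{(k)} = 0. -/
open Matrix

noncomputable section

/-- `Vn n` is the space of `n`-dimensional commutative complex algebras, i.e. symmetric
ℂ-bilinear maps `ℂⁿ × ℂⁿ → ℂⁿ`, encoded by structure constants with respect to the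
standard basis: `μ i j k` is the `e k`-coordinate of `μ(e i, e j)`. -/
abbrev Vn (n : ℕ) : Type := Fin n → Fin n → Fin n → ℂ

namespace Vn

variable {n : ℕ}

/-- symmetry (commutativity) of the multiplication -/
def IsSymm (μ : Vn n) : Prop := ∀ i j k, μ i j k = μ j i k

/-- the product `μ(x, y)` -/
def mul (μ : Vn n) (x y : Fin n → ℂ) : Fin n → ℂ :=
  fun k => ∑ i, ∑ j, x i * y j * μ i j k

/-- left multiplication `L^μ_x`, as a matrix -/
def L (μ : Vn n) (x : Fin n → ℂ) : Matrix (Fin n) (Fin n) ℂ :=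
  Matrix.of fun k j => ∑ i, x i * μ i j k

/-- the standard Hermitian inner product on `ℂⁿ` (linear in the first variable) -/
def herm (x y : Fin n → ℂ) : ℂ := ∑ i, x i * star (y i)

/-- the moment matrix `M_μ = -2 ∑ᵢ (L_{xᵢ})* L_{xᵢ} + ∑ᵢ L_{xᵢ} (L_{xᵢ})*`,
computed with respect to the standard orthonormal basis of `ℂⁿ` -/
def Mmat (μ : Vn n) : Matrix (Fin n) (Fin n) ℂ :=
  (-2 : ℂ) • ∑ i, (L μ (Pi.single i 1))ᴴ * L μ (Pi.single i 1)
    + ∑ i, L μ (Pi.single i 1) * (L μ (Pi.single i 1))ᴴ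

/-- the Hermitian product on `Vn n` -/
def innerV (μ ν : Vn n) : ℂ := ∑ i, ∑ j, ∑ k, μ i j k * star (ν i j k)

/-- the squared norm `‖μ‖²` on `Vn n` -/
def normSqV (μ : Vn n) : ℝ := ∑ i, ∑ j, ∑ k, Complex.normSq (μ i j k)

/-- the infinitesimal change-of-basis action of `gl(n, ℂ)` on `Vn n`:
`(A·μ)(x,y) = A(μ(x,y)) - μ(Ax,y) - μ(x,Ay)` -/
def glAct (A : Matrix (Fin n) (Fin n) ℂ) (μ : Vn n) : Vn n :=
  fun i j k =>
    (A *ᵥ mul μ (Pi.single i 1) (Pi.single j 1)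
      - mul μ (A *ᵥ Pi.single i 1) (Pi.single j 1)
      - mul μ (Pi.single i 1) (A *ᵥ Pi.single j 1)) k

/-- the change-of-basis action of `GL(n, ℂ)` on `Vn n`:
`(g·μ)(x,y) = g(μ(g⁻¹x, g⁻¹y))` -/
def gAct (g : GL (Fin n) ℂ) (μ : Vn n) : Vn n :=
  fun i j k =>
    ((g : Matrix (Fin n) (Fin n) ℂ) *ᵥ
      mul μ ((↑g⁻¹ : Matrix (Fin n) (Fin n) ℂ) *ᵥ Pi.single i 1)
            ((↑g⁻¹ : Matrix (Fin n) (Fin n) ℂ) *ᵥ Pi.single j 1)) k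

/-- the `GL(n,ℂ)`-orbit (isomorphism class) of `μ` -/
def orbit (μ : Vn n) : Set (Vn n) := { ν | ∃ g : GL (Fin n) ℂ, ν = gAct g μ }

/-- `D` is a derivation of `μ` -/
def IsDeriv (μ : Vn n) (D : Matrix (Fin n) (Fin n) ℂ) : Prop :=
  ∀ x y, D *ᵥ mul μ x y = mul μ (D *ᵥ x) y + mul μ x (D *ᵥ y)

/-- the associator `(a,b,c) = (ab)c - a(bc)` -/
def assoc (μ : Vn n) (a b c : Fin n → ℂ) : Fin n → ℂ :=
  mul μ (mul μ a b) c - mul μ a (mul μ b c)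

/-- `μ` is a Jordan algebra: commutative and satisfying the linearized Jordan identity
`(ab,c,d) + (bd,c,a) + (da,c,b) = 0` -/
def IsJordan (μ : Vn n) : Prop :=
  IsSymm μ ∧ ∀ a b c d : Fin n → ℂ,
    assoc μ (mul μ a b) c d + assoc μ (mul μ b d) c a + assoc μ (mul μ d a) c b = 0

/-- `μ` is a soliton: `μ ≠ 0` and `M_μ · μ ∈ ℝ μ` -/
def IsSoliton (μ : Vn n) : Prop :=
  μ ≠ 0 ∧ ∃ c : ℝ, glAct (Mmat μ) μ = (c : ℂ) • μ

/-- the constant `c_μ = -Tr(M_μ²)/‖μ‖²` -/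
def cconst (μ : Vn n) : ℝ := -(Matrix.trace (Mmat μ * Mmat μ)).re / normSqV μ

/-- `D_μ = M_μ - c_μ • I` -/
def Dmat (μ : Vn n) : Matrix (Fin n) (Fin n) ℂ := Mmat μ - (cconst μ : ℂ) • 1

/-- the energy `E_n(μ) = Tr(M_μ²)/‖μ‖⁴` -/
def energy (μ : Vn n) : ℝ := (Matrix.trace (Mmat μ * Mmat μ)).re / (normSqV μ) ^ 2

/-- the trace form `τ_μ(x, y) = Tr L_{μ(x,y)}` -/
def traceForm (μ : Vn n) (x y : Fin n → ℂ) : ℂ := Matrix.trace (L μ (mul μ x y))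

/-- nondegeneracy of the trace form (Albert's criterion for semisimplicity) -/
def TraceFormNondeg (μ : Vn n) : Prop := ∀ x, (∀ y, traceForm μ x y = 0) → x = 0

end Vn


/-- the powers `x^{(1)} = x`, `x^{(k+1)} = μ(x, x^{(k)})`; here `jpow μ x k = x^{(k+1)}`. -/
def Vn.jpow {n : ℕ} (μ : Vn n) (x : Fin n → ℂ) : ℕ → (Fin n → ℂ)
  | 0 => x
  | k + 1 => Vn.mul μ x (Vn.jpow μ x k)

namespace Vn

variable {n : ℕ}

lemma mul_single_single (μ : Vn n) (i j : Fin n) :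
    mul μ (Pi.single i 1) (Pi.single j 1) = μ i j := by
  funext k
  simp [mul, Pi.single_apply]

lemma glAct_apply (A : Matrix (Fin n) (Fin n) ℂ) (μ : Vn n) (i j k : Fin n) :
    glAct A μ i j k =
      ∑ l, A k l * μ i j l - ∑ l, A l i * μ l j k - ∑ l, A l j * μ i l k := by
  simp only [glAct, mul_single_single, Pi.sub_apply, mulVec_single_one]
  simp [mul, mulVec, dotProduct, Pi.single_apply, Matrix.col]

/-- The bilinear extension of the defining formula of `glAct`. -/
lemma mul_glAct (A : Matrix (Fin n) (Fin n) ℂ) (μ : Vn n) (x y : Fin n → ℂ) :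
    mul (glAct A μ) x y = A *ᵥ mul μ x y - mul μ (A *ᵥ x) y - mul μ x (A *ᵥ y) := by
  funext k
  simp only [mul, glAct_apply, Pi.sub_apply, mulVec, dotProduct, mul_sub, Finset.sum_sub_distrib,
    Finset.mul_sum, Finset.sum_mul]
  congr 1
  · congr 1
    · rw [Finset.sum_comm_cycle]
      exact Finset.sum_congr rfl fun l _ => Finset.sum_congr rfl fun i _ =>
        Finset.sum_congr rfl fun j _ => by ring
    · rw [Finset.sum_comm_cycle]
      refine Finset.sum_congr rfl fun l _ => ?_
      rw [Finset.sum_comm]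
      exact Finset.sum_congr rfl fun j _ => Finset.sum_congr rfl fun i _ => by ring
  · refine Finset.sum_congr rfl fun i _ => ?_
    rw [Finset.sum_comm]
    exact Finset.sum_congr rfl fun l _ => Finset.sum_congr rfl fun j _ => by ring

lemma isDeriv_of_glAct_eq_zero {A : Matrix (Fin n) (Fin n) ℂ} {μ : Vn n}
    (h : glAct A μ = 0) : IsDeriv μ A := by
  intro x y
  have key := mul_glAct A μ x y
  rw [h, show mul (0 : Vn n) x y = 0 by funext k; simp [mul], sub_sub] at key
  exact sub_eq_zero.mp key.symm

lemma Mmat_apply (μ : Vn n) (a b : Fin n) :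
    Mmat μ a b = -2 * (∑ i, ∑ k, star (μ i a k) * μ i b k)
      + ∑ i, ∑ j, μ i j a * star (μ i j b) := by
  simp [Mmat, L, Matrix.sum_apply, Matrix.mul_apply, Pi.single_apply]

/-- The moment matrix represents the infinitesimal action with respect to the trace pairing. -/
lemma innerV_glAct_self {μ : Vn n} (hμ : IsSymm μ) (A : Matrix (Fin n) (Fin n) ℂ) :
    innerV (glAct A μ) μ = trace (A * Mmat μ) := by
  have h₁ : ∑ i, ∑ j, ∑ k, (∑ l, A k l * μ i j l) * star (μ i j k)
      = ∑ a, ∑ b, A a b * ∑ i, ∑ j, μ i j b * star (μ i j a) := by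
    simp only [Finset.mul_sum, Finset.sum_mul]
    rw [Finset.sum_comm_cycle]
    refine Finset.sum_congr rfl fun k _ => ?_
    rw [Finset.sum_comm_cycle]
    exact Finset.sum_congr rfl fun l _ => Finset.sum_congr rfl fun i _ =>
      Finset.sum_congr rfl fun j _ => by ring
  have h₂ : ∑ i, ∑ j, ∑ k, (∑ l, A l j * μ i l k) * star (μ i j k)
      = ∑ a, ∑ b, A a b * ∑ i, ∑ k, star (μ i b k) * μ i a k := by
    simp only [Finset.mul_sum, Finset.sum_mul]
    rw [Finset.sum_congr rfl fun i _ => Finset.sum_comm_cycle, Finset.sum_comm]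
    refine Finset.sum_congr rfl fun l _ => ?_
    rw [Finset.sum_comm]
    exact Finset.sum_congr rfl fun j _ => Finset.sum_congr rfl fun i _ =>
      Finset.sum_congr rfl fun k _ => by ring
  have h₃ : ∑ i, ∑ j, ∑ k, (∑ l, A l i * μ l j k) * star (μ i j k)
      = ∑ i, ∑ j, ∑ k, (∑ l, A l j * μ i l k) * star (μ i j k) := by
    rw [Finset.sum_comm]
    refine Finset.sum_congr rfl fun i _ => Finset.sum_congr rfl fun j _ =>
      Finset.sum_congr rfl fun k _ => ?_
    rw [hμ j i k]
    simp only [hμ _ i k]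
  simp only [innerV, glAct_apply, sub_mul, Finset.sum_sub_distrib, h₁, h₂, h₃, trace, diag_apply,
    Matrix.mul_apply, Mmat_apply, mul_add, Finset.sum_add_distrib]
  simp only [mul_left_comm _ (-2 : ℂ), ← Finset.mul_sum]
  ring

lemma innerV_self (μ : Vn n) : innerV μ μ = normSqV μ := by
  simp [innerV, normSqV, Complex.mul_conj]

lemma normSqV_ne_zero {μ : Vn n} (hμ : μ ≠ 0) : normSqV μ ≠ 0 := by
  contrapose! hμ
  funext i j k
  have h₀ : ∀ i j k, 0 ≤ Complex.normSq (μ i j k) := fun _ _ _ => Complex.normSq_nonneg _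
  simp only [normSqV] at hμ
  rw [Finset.sum_eq_zero_iff_of_nonneg fun i _ =>
    Finset.sum_nonneg fun j _ => Finset.sum_nonneg fun k _ => h₀ i j k] at hμ
  have h₁ := hμ i (Finset.mem_univ _)
  rw [Finset.sum_eq_zero_iff_of_nonneg fun j _ => Finset.sum_nonneg fun k _ => h₀ i j k] at h₁
  have h₂ := h₁ j (Finset.mem_univ _)
  rw [Finset.sum_eq_zero_iff_of_nonneg fun k _ => h₀ i j k] at h₂
  exact Complex.normSq_eq_zero.mp (h₂ k (Finset.mem_univ _))

lemma glAct_sub_smul_one (A : Matrix (Fin n) (Fin n) ℂ) (c : ℂ) (μ : Vn n) :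
    glAct (A - c • 1) μ = glAct A μ + c • μ := by
  funext i j k
  simp [glAct_apply, sub_mul, Matrix.one_apply]
  ring

lemma isDeriv_Dmat {μ : Vn n} (hμ : IsSymm μ) (hS : IsSoliton μ) : IsDeriv μ (Dmat μ) := by
  obtain ⟨hne, c, hc⟩ := hS
  apply isDeriv_of_glAct_eq_zero
  have htr : trace (Mmat μ * Mmat μ) = ((c * normSqV μ : ℝ) : ℂ) := by
    rw [← innerV_glAct_self hμ, hc, Complex.ofReal_mul, ← innerV_self]
    simp [innerV, Finset.mul_sum, mul_assoc]
  have hcc : cconst μ = -c := by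
    rw [cconst, htr, Complex.ofReal_re]
    field_simp [normSqV_ne_zero hne]
  rw [Dmat, glAct_sub_smul_one, hc, hcc]
  simp

lemma mul_smul_left (μ : Vn n) (c : ℂ) (x y : Fin n → ℂ) : mul μ (c • x) y = c • mul μ x y := by
  funext k
  simp [mul, Finset.mul_sum, mul_assoc]

lemma mul_smul_right (μ : Vn n) (c : ℂ) (x y : Fin n → ℂ) : mul μ x (c • y) = c • mul μ x y := by
  funext k
  simp [mul, Finset.mul_sum, mul_assoc, mul_left_comm]

lemma IsDeriv.mulVec_jpow {μ : Vn n} {D : Matrix (Fin n) (Fin n) ℂ} (hD : IsDeriv μ D)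
    {x : Fin n → ℂ} {d : ℂ} (hx : D *ᵥ x = d • x) (k : ℕ) :
    D *ᵥ jpow μ x k = ((k + 1 : ℂ) * d) • jpow μ x k := by
  induction k with
  | zero => simpa [jpow] using hx
  | succ k ih =>
    rw [jpow, hD, ih, hx, mul_smul_left, mul_smul_right, ← add_smul]
    congr 1
    push_cast
    ring

/-- An eigenvector of a derivation with nonzero eigenvalue is nilpotent. -/
lemma IsDeriv.exists_jpow_eq_zero {μ : Vn n} {D : Matrix (Fin n) (Fin n) ℂ} (hD : IsDeriv μ D)
    {x : Fin n → ℂ} {d : ℂ} (hd : d ≠ 0) (hx : D *ᵥ x = d • x) : ∃ k, jpow μ x k = 0 := by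
  by_contra! h
  have hinj : Function.Injective fun k : ℕ => (k + 1 : ℂ) * d := fun a b hab => by
    simpa [hd] using hab
  have hli := Module.End.eigenvectors_linearIndependent' (Matrix.toLin' D) _ hinj (jpow μ x)
    fun k => Module.End.hasEigenvector_iff.mpr
      ⟨Module.End.mem_eigenspace_iff.mpr (by simpa using hD.mulVec_jpow hx k), h k⟩
  exact not_finite_iff_infinite.mpr inferInstance hli.finite

end Vn

/-- if `μ ∈ 𝒥_n` is a soliton and `x` satisfies `D_μ x = d x` with `d` real
nonzero, then `x` is nilpotent: `x^{(k)} = 0` for some `k ≥ 1`. -/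
theorem stmt5 {n : ℕ} (μ : Vn n) (hJ : Vn.IsJordan μ) (hS : Vn.IsSoliton μ)
    (x : Fin n → ℂ) (d : ℝ) (hd : d ≠ 0)
    (hx : Vn.Dmat μ *ᵥ x = (d : ℂ) • x) :
    ∃ k : ℕ, Vn.jpow μ x k = 0 :=
  (Vn.isDeriv_Dmat hJ.1 hS).exists_jpow_eq_zero (Complex.ofReal_ne_zero.mpr hd) hx
end
end

section
/- Degenerations do not decrease the soliton energy: let μ, ν ∈ 𝒥_n be nonzero, and suppose the orbit GL(n,ℂ)·μ contains a soliton λ with E_n(λ) > E_n(ν). Then μ does not degenerate to ν, i.e., ν does not lie in the closure of GL(n,ℂ)·μ in V_n. -/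
open Matrix

noncomputable section

namespace Vn

variable {n : ℕ}

/-- The matrix of left multiplication by the `i`-th standard basis vector. -/
def basisL (μ : Vn n) (i : Fin n) : Matrix (Fin n) (Fin n) ℂ := Matrix.of fun k j => μ i j k

/-- The product `g(μ(hx, hy))`; for `h = g⁻¹` it is the change-of-basis action of `g`. -/
def twist (g h : Matrix (Fin n) (Fin n) ℂ) (μ : Vn n) : Vn n :=
  fun i j k => (∑ a, h a i • (g * basisL μ a * h)) k j

theorem ext_basisL {μ ν : Vn n} (h : ∀ i, basisL μ i = basisL ν i) : μ = ν := by
  funext i j k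
  exact congrFun (congrFun (h i) k) j

theorem L_single (μ : Vn n) (i : Fin n) : L μ (Pi.single i 1) = basisL μ i := by
  ext k j
  simp [L, basisL, Pi.single_apply]

theorem basisL_twist (g h : Matrix (Fin n) (Fin n) ℂ) (μ : Vn n) (i : Fin n) :
    basisL (twist g h μ) i = ∑ a, h a i • (g * basisL μ a * h) := rfl

theorem twist_apply (g h : Matrix (Fin n) (Fin n) ℂ) (μ : Vn n) (i j k : Fin n) :
    twist g h μ i j k = ∑ a, ∑ b, ∑ c, h a i * (g k c * μ a b c * h b j) := by
  simp only [twist, Matrix.sum_apply, Matrix.smul_apply, smul_eq_mul, Matrix.mul_apply, basisL,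
    Matrix.of_apply, Finset.sum_mul, Finset.mul_sum]

theorem gAct_eq_twist (g : GL (Fin n) ℂ) (μ : Vn n) :
    gAct g μ = twist (g : Matrix (Fin n) (Fin n) ℂ) (↑g⁻¹ : Matrix (Fin n) (Fin n) ℂ) μ := by
  funext i j k
  rw [twist_apply]
  simp only [gAct, Matrix.mulVec_single_one]
  simp only [mul, Matrix.mulVec, dotProduct, Matrix.col_apply, Finset.mul_sum]
  rw [Finset.sum_comm]
  refine Finset.sum_congr rfl fun a _ => ?_
  rw [Finset.sum_comm]
  exact Finset.sum_congr rfl fun b _ => Finset.sum_congr rfl fun c _ => by ring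

theorem basisL_glAct (A : Matrix (Fin n) (Fin n) ℂ) (μ : Vn n) (i : Fin n) :
    basisL (glAct A μ) i = A * basisL μ i - ∑ a, A a i • basisL μ a - basisL μ i * A := by
  ext k j
  simp [glAct, mul, basisL, Matrix.mul_apply, Matrix.sum_apply,
    Pi.single_apply, Matrix.mulVec, dotProduct, mul_comm]

theorem twist_twist (g h g' h' : Matrix (Fin n) (Fin n) ℂ) (μ : Vn n) :
    twist g h (twist g' h' μ) = twist (g * g') (h' * h) μ := by
  refine ext_basisL fun i => ?_
  simp only [basisL_twist, Finset.mul_sum, Finset.sum_mul, Finset.smul_sum, Matrix.mul_apply,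
    Finset.sum_smul]
  rw [Finset.sum_comm]
  refine Finset.sum_congr rfl fun a _ => Finset.sum_congr rfl fun b _ => ?_
  simp only [Matrix.mul_smul, Matrix.smul_mul, smul_smul, Matrix.mul_assoc]
  rw [mul_comm]

theorem twist_one (μ : Vn n) : twist 1 1 μ = μ := by
  refine ext_basisL fun i => ?_
  simp [basisL_twist, Matrix.one_apply]

theorem IsSymm.twist {μ : Vn n} (hμ : IsSymm μ) (g h : Matrix (Fin n) (Fin n) ℂ) :
    IsSymm (twist g h μ) := by
  intro i j k
  rw [twist_apply, twist_apply, Finset.sum_comm]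
  refine Finset.sum_congr rfl fun a _ => Finset.sum_congr rfl fun b _ =>
    Finset.sum_congr rfl fun c _ => ?_
  rw [hμ b a c]
  ring

theorem twist_smul (g h : Matrix (Fin n) (Fin n) ℂ) (c : ℂ) (μ : Vn n) :
    twist g h (c • μ) = c • twist g h μ := by
  funext i j k
  simp only [Pi.smul_apply, smul_eq_mul, twist_apply, Finset.mul_sum]
  refine Finset.sum_congr rfl fun a _ => Finset.sum_congr rfl fun b _ =>
    Finset.sum_congr rfl fun d _ => ?_
  ring

theorem twist_zero (g h : Matrix (Fin n) (Fin n) ℂ) : twist g h 0 = 0 := by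
  funext i j k
  simp [twist_apply]

theorem glAct_twist {g h : Matrix (Fin n) (Fin n) ℂ} (hhg : h * g = 1)
    (A : Matrix (Fin n) (Fin n) ℂ) (μ : Vn n) :
    glAct (g * A * h) (twist g h μ) = twist g h (glAct A μ) := by
  have cancel : ∀ X : Matrix (Fin n) (Fin n) ℂ, h * (g * X) = X := fun X => by
    rw [← Matrix.mul_assoc, hhg, Matrix.one_mul]
  refine ext_basisL fun i => ?_
  have hmid : ∑ b, (g * A * h) b i • basisL (twist g h μ) b
      = ∑ a, (A * h) a i • (g * basisL μ a * h) := by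
    have : A * h = h * (g * A * h) := by rw [Matrix.mul_assoc g, cancel]
    rw [this]
    simp only [basisL_twist, Matrix.mul_apply (M := h), Finset.smul_sum, Finset.sum_smul, smul_smul]
    rw [Finset.sum_comm]
    simp only [mul_comm]
  rw [basisL_glAct, hmid]
  simp only [basisL_twist, basisL_glAct, Matrix.mul_sub, Matrix.sub_mul, smul_sub,
    Finset.sum_sub_distrib, Finset.mul_sum, Finset.sum_mul, Matrix.mul_smul, Matrix.smul_mul,
    Matrix.mul_assoc, cancel, Finset.smul_sum, smul_smul]
  congr 2
  rw [Finset.sum_comm]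
  refine Finset.sum_congr rfl fun a _ => ?_
  rw [Matrix.mul_apply, Finset.sum_smul]
  simp only [mul_comm]

theorem Mmat_eq (μ : Vn n) :
    Mmat μ = (-2 : ℂ) • ∑ i, (basisL μ i)ᴴ * basisL μ i + ∑ i, basisL μ i * (basisL μ i)ᴴ := by
  simp only [Mmat, L_single]

theorem sum_unitary_combination {U : Matrix (Fin n) (Fin n) ℂ} (hU : Uᴴ * U = 1)
    (F : Fin n → Fin n → Matrix (Fin n) (Fin n) ℂ) :
    ∑ i, ∑ a, ∑ b, (Uᴴ a i * star (Uᴴ b i)) • F a b = ∑ a, F a a := by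
  rw [Finset.sum_comm]
  refine Finset.sum_congr rfl fun a _ => ?_
  rw [Finset.sum_comm]
  simp only [← Finset.sum_smul]
  have : ∀ b, ∑ i, Uᴴ a i * star (Uᴴ b i) = (1 : Matrix (Fin n) (Fin n) ℂ) a b := by
    intro b
    rw [← hU, Matrix.mul_apply]
    simp [Matrix.conjTranspose_apply]
  simp only [this, Matrix.one_apply, ite_smul, one_smul, zero_smul, Finset.sum_ite_eq,
    Finset.mem_univ, if_true]

theorem sum_basisL_twist_unitary_mul_conjTranspose {U : Matrix (Fin n) (Fin n) ℂ}
    (hU : Uᴴ * U = 1) (μ : Vn n) :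
    ∑ i, basisL (twist U Uᴴ μ) i * (basisL (twist U Uᴴ μ) i)ᴴ
      = U * (∑ i, basisL μ i * (basisL μ i)ᴴ) * Uᴴ := by
  have cancel : ∀ X : Matrix (Fin n) (Fin n) ℂ, Uᴴ * (U * X) = X := fun X => by
    rw [← Matrix.mul_assoc, hU, Matrix.one_mul]
  rw [Finset.mul_sum, Finset.sum_mul,
    ← sum_unitary_combination hU (fun a b => U * (basisL μ a * (basisL μ b)ᴴ) * Uᴴ)]
  refine Finset.sum_congr rfl fun i _ => ?_
  rw [basisL_twist, Matrix.conjTranspose_sum, Finset.sum_mul]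
  refine Finset.sum_congr rfl fun a _ => ?_
  rw [Finset.mul_sum]
  refine Finset.sum_congr rfl fun b _ => ?_
  simp only [Matrix.conjTranspose_smul, Matrix.conjTranspose_mul,
    Matrix.conjTranspose_conjTranspose, Matrix.smul_mul, Matrix.mul_smul, smul_smul,
    Matrix.mul_assoc, cancel, mul_comm (star _)]

theorem sum_conjTranspose_mul_basisL_twist_unitary {U : Matrix (Fin n) (Fin n) ℂ}
    (hU : Uᴴ * U = 1) (μ : Vn n) :
    ∑ i, (basisL (twist U Uᴴ μ) i)ᴴ * basisL (twist U Uᴴ μ) i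
      = U * (∑ i, (basisL μ i)ᴴ * basisL μ i) * Uᴴ := by
  have cancel : ∀ X : Matrix (Fin n) (Fin n) ℂ, Uᴴ * (U * X) = X := fun X => by
    rw [← Matrix.mul_assoc, hU, Matrix.one_mul]
  rw [Finset.mul_sum, Finset.sum_mul,
    ← sum_unitary_combination hU (fun a b => U * ((basisL μ b)ᴴ * basisL μ a) * Uᴴ)]
  refine Finset.sum_congr rfl fun i _ => ?_
  rw [basisL_twist, Matrix.conjTranspose_sum, Finset.mul_sum]
  refine Finset.sum_congr rfl fun a _ => ?_
  rw [Finset.sum_mul]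
  refine Finset.sum_congr rfl fun b _ => ?_
  simp only [Matrix.conjTranspose_smul, Matrix.conjTranspose_mul,
    Matrix.conjTranspose_conjTranspose, Matrix.smul_mul, Matrix.mul_smul, smul_smul,
    Matrix.mul_assoc, cancel]

theorem Mmat_twist_unitary {U : Matrix (Fin n) (Fin n) ℂ} (hU : Uᴴ * U = 1) (μ : Vn n) :
    Mmat (twist U Uᴴ μ) = U * Mmat μ * Uᴴ := by
  rw [Mmat_eq, Mmat_eq, sum_basisL_twist_unitary_mul_conjTranspose hU,
    sum_conjTranspose_mul_basisL_twist_unitary hU, Matrix.mul_add, Matrix.add_mul,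
    Matrix.mul_smul, Matrix.smul_mul]

theorem normSqV_eq_trace (μ : Vn n) :
    normSqV μ = (Matrix.trace (∑ i, basisL μ i * (basisL μ i)ᴴ)).re := by
  simp only [normSqV, Matrix.trace_sum, Complex.re_sum]
  refine Finset.sum_congr rfl fun i _ => ?_
  rw [Finset.sum_comm]
  simp [Matrix.trace, Matrix.mul_apply, basisL, Complex.mul_conj]

theorem normSqV_twist_unitary {U : Matrix (Fin n) (Fin n) ℂ} (hU : Uᴴ * U = 1) (μ : Vn n) :
    normSqV (twist U Uᴴ μ) = normSqV μ := by
  rw [normSqV_eq_trace, normSqV_eq_trace, sum_basisL_twist_unitary_mul_conjTranspose hU,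
    Matrix.trace_mul_comm, ← Matrix.mul_assoc, hU, Matrix.one_mul]

theorem energy_twist_unitary {U : Matrix (Fin n) (Fin n) ℂ} (hU : Uᴴ * U = 1) (μ : Vn n) :
    energy (twist U Uᴴ μ) = energy μ := by
  have h : U * Mmat μ * Uᴴ * (U * Mmat μ * Uᴴ) = U * (Mmat μ * Mmat μ * Uᴴ) := by
    simp only [Matrix.mul_assoc]
    rw [← Matrix.mul_assoc Uᴴ, hU, Matrix.one_mul]
  rw [energy, energy, normSqV_twist_unitary hU, Mmat_twist_unitary hU, h, Matrix.trace_mul_comm,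
    Matrix.mul_assoc, hU, Matrix.mul_one]

theorem Mmat_isHermitian (μ : Vn n) : (Mmat μ).IsHermitian := by
  rw [Matrix.IsHermitian, Mmat_eq]
  simp [Matrix.conjTranspose_sum]

theorem normSqV_pos {μ : Vn n} (hμ : μ ≠ 0) : 0 < normSqV μ := by
  have hnn : ∀ i j, 0 ≤ ∑ k, Complex.normSq (μ i j k) := fun i j =>
    Finset.sum_nonneg fun k _ => Complex.normSq_nonneg _
  refine lt_of_le_of_ne
    (Finset.sum_nonneg fun i _ => Finset.sum_nonneg fun j _ => hnn i j) fun h => hμ ?_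
  funext i j k
  have h1 := (Finset.sum_eq_zero_iff_of_nonneg
    fun i _ => Finset.sum_nonneg fun j _ => hnn i j).1 h.symm i (Finset.mem_univ i)
  have h2 := (Finset.sum_eq_zero_iff_of_nonneg fun j _ => hnn i j).1 h1 j (Finset.mem_univ j)
  have h3 := (Finset.sum_eq_zero_iff_of_nonneg
    fun k _ => Complex.normSq_nonneg _).1 h2 k (Finset.mem_univ k)
  exact Complex.normSq_eq_zero.1 h3

theorem re_Mmat_diag (μ : Vn n) (a : Fin n) :
    (Mmat μ a a).re = -2 * ∑ i, ∑ k, Complex.normSq (μ i a k)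
      + ∑ i, ∑ j, Complex.normSq (μ i j a) := by
  have h1 : ∀ z : ℂ, (starRingEnd ℂ) z * z = (Complex.normSq z : ℂ) := fun z => by
    rw [mul_comm, Complex.mul_conj]
  have h2 : Mmat μ a a = ((-2 * ∑ i, ∑ k, Complex.normSq (μ i a k)
      + ∑ i, ∑ j, Complex.normSq (μ i j a) : ℝ) : ℂ) := by
    simp [Mmat_eq, Matrix.sum_apply, Matrix.mul_apply, basisL, Complex.mul_conj, h1]
  rw [h2, Complex.ofReal_re]

/-- Pairing the moment matrix with a real diagonal matrix `diag d` computes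
`⟨diag d · μ, μ⟩`. -/
theorem sum_mul_re_Mmat_diag {μ : Vn n} (hμ : IsSymm μ) (d : Fin n → ℝ) :
    ∑ a, d a * (Mmat μ a a).re
      = ∑ i, ∑ j, ∑ k, (d k - d i - d j) * Complex.normSq (μ i j k) := by
  have hi : ∑ i, ∑ j, ∑ k, d i * Complex.normSq (μ i j k)
      = ∑ i, ∑ j, ∑ k, d j * Complex.normSq (μ i j k) := by
    rw [Finset.sum_comm]
    refine Finset.sum_congr rfl fun i _ => Finset.sum_congr rfl fun j _ =>
      Finset.sum_congr rfl fun k _ => ?_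
    rw [hμ]
  have hj : ∑ a, d a * ∑ i, ∑ k, Complex.normSq (μ i a k)
      = ∑ i, ∑ j, ∑ k, d j * Complex.normSq (μ i j k) := by
    simp only [Finset.mul_sum]
    exact Finset.sum_comm
  have hk : ∑ a, d a * ∑ i, ∑ j, Complex.normSq (μ i j a)
      = ∑ i, ∑ j, ∑ k, d k * Complex.normSq (μ i j k) := by
    simp only [Finset.mul_sum]
    rw [Finset.sum_comm]
    exact Finset.sum_congr rfl fun i _ => Finset.sum_comm
  simp only [sub_mul, Finset.sum_sub_distrib, re_Mmat_diag, mul_add, Finset.sum_add_distrib,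
    mul_left_comm _ (-2 : ℝ)]
  rw [← Finset.mul_sum, hj, hk, hi]
  ring

theorem sum_sq_re_diag_le_trace_sq {M : Matrix (Fin n) (Fin n) ℂ} (hM : M.IsHermitian) :
    ∑ a, (M a a).re ^ 2 ≤ (Matrix.trace (M * M)).re := by
  have h : (Matrix.trace (M * M)).re = ∑ a, ∑ b, Complex.normSq (M a b) := by
    simp only [Matrix.trace, Matrix.diag_apply, Matrix.mul_apply, Complex.re_sum]
    refine Finset.sum_congr rfl fun a _ => Finset.sum_congr rfl fun b _ => ?_
    rw [← hM.apply b a, Complex.star_def, Complex.mul_conj, Complex.ofReal_re]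
  rw [h]
  refine Finset.sum_le_sum fun a _ => ?_
  calc (M a a).re ^ 2 ≤ Complex.normSq (M a a) := by
        rw [Complex.normSq_apply]
        nlinarith [mul_self_nonneg (M a a).im]
    _ ≤ _ := Finset.single_le_sum (f := fun b => Complex.normSq (M a b))
        (fun b _ => Complex.normSq_nonneg _) (Finset.mem_univ a)

/-- QR decomposition with respect to the preorder on the indices given by a real weight. -/
theorem exists_unitary_conjTranspose_mul_triangular (d : Fin n → ℝ)
    (g : Matrix (Fin n) (Fin n) ℂ) :
    ∃ Q : Matrix (Fin n) (Fin n) ℂ, Qᴴ * Q = 1 ∧ ∀ a b, d a < d b → (Qᴴ * g) a b = 0 := by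
  let σ := Tuple.sort fun i => -d i
  have hσ : Monotone ((fun i => -d i) ∘ σ) := Tuple.monotone_sort _
  let f : Fin n → EuclideanSpace ℂ (Fin n) := fun j => WithLp.toLp 2 fun i => g i (σ j)
  let B := InnerProductSpace.gramSchmidtOrthonormalBasis (𝕜 := ℂ) (by simp) f
  have hQ : ∀ a b, ((Matrix.of fun i j => B (σ.symm j) i)ᴴ * g : Matrix (Fin n) (Fin n) ℂ) a b
      = inner ℂ (B (σ.symm a)) (f (σ.symm b)) := by
    intro a b
    simp [Matrix.mul_apply, PiLp.inner_apply, f, mul_comm]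
  refine ⟨Matrix.of fun i j => B (σ.symm j) i, ?_, fun a b hab => ?_⟩
  · ext a b
    have h := orthonormal_iff_ite.1 B.orthonormal (σ.symm a) (σ.symm b)
    simp only [EmbeddingLike.apply_eq_iff_eq] at h
    rw [Matrix.one_apply, ← h]
    simp [Matrix.mul_apply, PiLp.inner_apply, mul_comm]
  · rw [hQ]
    refine InnerProductSpace.gramSchmidtOrthonormalBasis_inv_triangular _ _ ?_
    by_contra! hle
    have := hσ hle
    simp at this
    linarith

theorem mul_div_sq_le_div_sq {c N N' T : ℝ} (hc : 0 ≤ c) (hN : 0 < N) (hN' : 0 < N')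
    (hT : 0 ≤ T) (h : (c * N') ^ 2 ≤ c * N * T) : c * N / N ^ 2 ≤ T / N' ^ 2 := by
  rw [div_le_div_iff₀ (by positivity) (by positivity)]
  rcases hc.eq_or_lt with rfl | hcpos
  · simp only [zero_mul]
    positivity
  have hmain : c * N' ^ 2 ≤ N * T := le_of_mul_le_mul_left (by linarith) hcpos
  calc c * N * N' ^ 2 = N * (c * N' ^ 2) := by ring
    _ ≤ N * (N * T) := mul_le_mul_of_nonneg_left hmain hN.le
    _ = T * N ^ 2 := by ring

/-- The energy of a soliton with diagonal moment matrix is minimal along its orbit. -/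
theorem energy_le_energy_twist_of_diagonal {μ : Vn n} (hsymm : IsSymm μ) (hμ : μ ≠ 0)
    {d : Fin n → ℝ} (hd : Mmat μ = Matrix.diagonal fun i => (d i : ℂ)) {c : ℝ}
    (hc : glAct (Mmat μ) μ = (c : ℂ) • μ) {g h : Matrix (Fin n) (Fin n) ℂ} (hgh : g * h = 1) :
    energy μ ≤ energy (twist g h μ) := by
  have hweight : ∀ i j k, μ i j k ≠ 0 → d k - d i - d j = c := by
    intro i j k hne
    have h1 := congrFun (congrFun (congrArg (fun ν => basisL ν i) hc) k) j
    rw [basisL_glAct, hd] at h1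
    simp only [Matrix.sub_apply, Matrix.diagonal_mul, Matrix.mul_diagonal, Matrix.sum_apply,
      Matrix.smul_apply, Matrix.diagonal_apply, basisL, Matrix.of_apply, Pi.smul_apply,
      smul_eq_mul, ite_mul, zero_mul, Finset.sum_ite_eq', Finset.mem_univ, if_true] at h1
    have h2 : ((d k - d i - d j - c : ℝ) : ℂ) * μ i j k = 0 := by
      push_cast
      linear_combination h1
    have h3 := (mul_eq_zero.1 h2).resolve_right hne
    have h4 : d k - d i - d j - c = 0 := by exact_mod_cast h3
    linarith
  obtain ⟨Q, hQ, htri⟩ := exists_unitary_conjTranspose_mul_triangular d g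
  have hQ' : Q * Qᴴ = 1 := mul_eq_one_comm.1 hQ
  set p := Qᴴ * g with hp
  set q := h * Q with hq
  have hpq : p * q = 1 := by
    rw [hp, hq, Matrix.mul_assoc, ← Matrix.mul_assoc g, hgh, Matrix.one_mul, hQ]
  have hptri : p.BlockTriangular (fun i => OrderDual.toDual (d i)) := fun a b hab => htri a b hab
  have hqtri : ∀ a b, d a < d b → q a b = 0 := by
    have hinv : p⁻¹ = q := Matrix.inv_eq_right_inv hpq
    let := invertibleOfRightInverse p q hpq
    have := Matrix.blockTriangular_inv_of_blockTriangular hptri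
    rw [hinv] at this
    exact fun a b hab => this hab
  have htw : twist g h μ = twist Q Qᴴ (twist p q μ) := by
    rw [twist_twist, hp, hq, ← Matrix.mul_assoc, hQ', Matrix.one_mul, Matrix.mul_assoc, hQ',
      Matrix.mul_one]
  rw [htw, energy_twist_unitary hQ]
  have hρsymm : IsSymm (twist p q μ) := hsymm.twist p q
  have hρ0 : twist p q μ ≠ 0 := by
    intro h0
    have hqp : q * p = 1 := mul_eq_one_comm.1 hpq
    rw [← twist_one μ, ← hqp, ← twist_twist, h0, twist_zero] at hμ
    exact hμ rfl
  set ρ := twist p q μ with hρ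
  have hρweight : ∀ i j k, ρ i j k ≠ 0 → c ≤ d k - d i - d j := by
    intro i j k hne
    by_contra! hlt
    apply hne
    rw [hρ, twist_apply]
    refine Finset.sum_eq_zero fun a _ => Finset.sum_eq_zero fun b _ =>
      Finset.sum_eq_zero fun e _ => ?_
    by_cases h0 : μ a b e = 0
    · simp [h0]
    have hw := hweight a b e h0
    by_cases h1 : d k < d e
    · simp [htri k e h1]
    by_cases h2 : d a < d i
    · simp [hqtri a i h2]
    by_cases h3 : d b < d j
    · simp [hqtri b j h3]
    linarith
  have hNμ := normSqV_pos hμ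
  have hNρ := normSqV_pos hρ0
  have hdiag : ∀ a, (Mmat μ a a).re = d a := fun a => by simp [hd]
  have hS : ∑ a, d a ^ 2 = c * normSqV μ := by
    have h1 := sum_mul_re_Mmat_diag hsymm d
    simp only [hdiag, ← pow_two] at h1
    rw [h1]
    simp only [normSqV, Finset.mul_sum]
    refine Finset.sum_congr rfl fun i _ => Finset.sum_congr rfl fun j _ =>
      Finset.sum_congr rfl fun k _ => ?_
    by_cases h0 : μ i j k = 0
    · simp [h0]
    · rw [hweight i j k h0]
  have htrace : (Matrix.trace (Mmat μ * Mmat μ)).re = c * normSqV μ := by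
    rw [← hS, hd]
    simp [Matrix.trace, pow_two]
  have hpair : c * normSqV ρ ≤ ∑ a, d a * (Mmat ρ a a).re := by
    rw [sum_mul_re_Mmat_diag hρsymm]
    simp only [normSqV, Finset.mul_sum]
    refine Finset.sum_le_sum fun i _ => Finset.sum_le_sum fun j _ =>
      Finset.sum_le_sum fun k _ => ?_
    by_cases h0 : ρ i j k = 0
    · simp [h0]
    · exact mul_le_mul_of_nonneg_right (hρweight i j k h0) (Complex.normSq_nonneg _)
  have hc0 : 0 ≤ c := by
    have : 0 ≤ c * normSqV μ := hS ▸ Finset.sum_nonneg fun a _ => sq_nonneg _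
    exact nonneg_of_mul_nonneg_left this hNμ
  have hcs := Finset.sum_mul_sq_le_sq_mul_sq Finset.univ d fun a => (Mmat ρ a a).re
  have hT := sum_sq_re_diag_le_trace_sq (Mmat_isHermitian ρ)
  rw [hS] at hcs
  rw [energy, energy, htrace]
  exact mul_div_sq_le_div_sq hc0 hNμ hNρ ((Finset.sum_nonneg fun a _ => sq_nonneg _).trans hT)
    ((pow_le_pow_left₀ (mul_nonneg hc0 hNρ.le) hpair 2).trans
      (hcs.trans (mul_le_mul_of_nonneg_left hT (mul_nonneg hc0 hNμ.le))))

theorem energy_le_energy_twist {μ : Vn n} (hsymm : IsSymm μ) (hsol : IsSoliton μ)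
    {g h : Matrix (Fin n) (Fin n) ℂ} (hgh : g * h = 1) :
    energy μ ≤ energy (twist g h μ) := by
  obtain ⟨hμ, c, hc⟩ := hsol
  have hM := Mmat_isHermitian μ
  set V : Matrix (Fin n) (Fin n) ℂ := (hM.eigenvectorUnitary : Matrix (Fin n) (Fin n) ℂ) with hV
  have hVV : Vᴴ * V = 1 := Unitary.coe_star_mul_self hM.eigenvectorUnitary
  have hVV' : V * Vᴴ = 1 := mul_eq_one_comm.1 hVV
  have hU : (Vᴴ)ᴴ * Vᴴ = 1 := by rwa [Matrix.conjTranspose_conjTranspose]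
  have hdiag : Vᴴ * Mmat μ * V = Matrix.diagonal fun i => (hM.eigenvalues i : ℂ) := by
    have := hM.conjStarAlgAut_star_eigenvectorUnitary
    rwa [Unitary.conjStarAlgAut_star_apply] at this
  have hback : twist V Vᴴ (twist Vᴴ V μ) = μ := by
    rw [twist_twist, hVV', twist_one]
  have htw : twist g h μ = twist (g * V) (Vᴴ * h) (twist Vᴴ V μ) := by
    rw [twist_twist, Matrix.mul_assoc, hVV', Matrix.mul_one, ← Matrix.mul_assoc, hVV',
      Matrix.one_mul]
  have hMt : Mmat (twist Vᴴ V μ) = Vᴴ * Mmat μ * V := by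
    simpa using Mmat_twist_unitary hU μ
  have hE : energy (twist Vᴴ V μ) = energy μ := by
    simpa using energy_twist_unitary hU μ
  rw [htw, ← hE]
  refine energy_le_energy_twist_of_diagonal (hsymm.twist _ _) ?_ (hMt.trans hdiag) (c := c) ?_ ?_
  · intro h0
    rw [← hback, h0, twist_zero] at hμ
    exact hμ rfl
  · rw [hMt, glAct_twist hVV', hc, twist_smul]
  · rw [Matrix.mul_assoc, ← Matrix.mul_assoc V, hVV', Matrix.one_mul, hgh]

theorem continuousAt_energy {ν : Vn n} (hν : ν ≠ 0) : ContinuousAt energy ν := by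
  have hL : ∀ i, Continuous fun μ : Vn n => basisL μ i := fun i =>
    continuous_matrix fun k j => by
      simp only [basisL, Matrix.of_apply]
      fun_prop
  have hM : Continuous fun μ : Vn n => Mmat μ := by
    simp only [Mmat_eq]
    fun_prop
  have hN : Continuous fun μ : Vn n => normSqV μ := by
    simp only [normSqV_eq_trace]
    fun_prop
  refine ContinuousAt.div ?_ (hN.pow 2).continuousAt (pow_ne_zero 2 (normSqV_pos hν).ne')
  exact (Complex.continuous_re.comp (hM.matrix_mul hM).matrix_trace).continuousAt

end Vn


/-- degenerations do not decrease the soliton energy: if the orbit of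
`μ ∈ 𝒥_n` contains a soliton `lam` with `E_n(lam) > E_n(ν)`, then `μ` does not degenerate
to `ν`. -/
theorem stmt12 {n : ℕ} (μ ν : Vn n) (hμ : Vn.IsJordan μ) (hν : Vn.IsJordan ν)
    (hμ0 : μ ≠ 0) (hν0 : ν ≠ 0)
    (lam : Vn n) (hlam : lam ∈ Vn.orbit μ) (hsol : Vn.IsSoliton lam)
    (hE : Vn.energy ν < Vn.energy lam) :
    ν ∉ closure (Vn.orbit μ) := by
  intro hcl
  obtain ⟨g₀, rfl⟩ := hlam
  have hsymm : Vn.IsSymm (Vn.gAct g₀ μ) := by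
    rw [Vn.gAct_eq_twist]
    exact hμ.1.twist _ _
  obtain ⟨ρ, hρ, g, rfl⟩ := (mem_closure_iff_frequently.1 hcl).and_eventually
    ((Vn.continuousAt_energy hν0).eventually_lt_const hE) |>.exists.imp fun ρ h => h.symm
  refine absurd hρ (not_lt.2 ?_)
  have h : Vn.gAct g μ = Vn.twist ((g * g₀⁻¹ : GL (Fin n) ℂ) : Matrix (Fin n) (Fin n) ℂ)
      ((g₀ * g⁻¹ : GL (Fin n) ℂ) : Matrix (Fin n) (Fin n) ℂ) (Vn.gAct g₀ μ) := by
    rw [Vn.gAct_eq_twist, Vn.gAct_eq_twist, Vn.twist_twist, ← Units.val_mul, ← Units.val_mul]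
    simp
  rw [h]
  refine Vn.energy_le_energy_twist hsymm hsol ?_
  rw [← Units.val_mul]
  simp
end
end
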